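/- Let ω be a weight function with constant K, τ ∈ (0,1), g ∈ 𝒮_ω(ℝᴺ) nonzero, 1 ≤ p ≤ ∞, p' conjugate. For every λ ≥ 0 and f ∈ 𝒮_ω(ℝᴺ): ‖e^{λω} Sp_g f‖_∞ ≤ e^{Kλ} ‖e^{Kλω} Wig_{1−τ}(g̃)‖_{p'} ‖e^{Kλω} Wig_τ(f)‖_p, where g̃(t) = g(−t). -/

import Mathlib

open MeasureTheory Complex ENNReal

noncomputable section

abbrev RN (N : ℕ) := Fin N → ℝ

def dotR {N : ℕ} (x y : RN N) : ℝ := ∑ i, x i * y i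

def stft {N : ℕ} (g f : RN N → ℂ) (x ξ : RN N) : ℂ :=
  ∫ y, f y * (starRingEnd ℂ) (g (y - x)) * Complex.exp (-(Complex.I * (dotR y ξ : ℂ)))

def ftr {N : ℕ} (f : RN N → ℂ) (ξ : RN N) : ℂ :=
  ∫ x, Complex.exp (-(Complex.I * (dotR x ξ : ℂ))) * f x

def rihaczek {N : ℕ} (f : RN N → ℂ) (x ξ : RN N) : ℂ :=
  Complex.exp (-(Complex.I * (dotR x ξ : ℂ))) * f x * (starRingEnd ℂ) (ftr f ξ)

def spec {N : ℕ} (g f : RN N → ℂ) (x ξ : RN N) : ℝ := ‖stft g f x ξ‖ ^ 2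

def wig {N : ℕ} (τ : ℝ) (f : RN N → ℂ) (x ξ : RN N) : ℂ :=
  ∫ t, Complex.exp (-(Complex.I * (dotR t ξ : ℂ))) * f (x + τ • t) *
    (starRingEnd ℂ) (f (x - (1 - τ) • t))

structure WeightFunction where
  w : ℝ → ℝ
  K : ℝ
  a : ℝ
  b : ℝ
  oneLeK : 1 ≤ K
  bpos : 0 < b
  cont : Continuous w
  mono : MonotoneOn w (Set.Ici 0)
  nonneg : ∀ t, 0 ≤ w t
  alpha : ∀ t, 0 ≤ t → w (2 * t) ≤ K * (1 + w t)
  beta : Filter.Tendsto (fun t => w t / t) Filter.atTop (nhds 0)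
  gamma : ∀ t, 0 ≤ t → a + b * Real.log (1 + t) ≤ w t
  delta : ConvexOn ℝ Set.univ (fun t => w (Real.exp t))
  subadd : ∀ s t, 0 ≤ s → 0 ≤ t → w (s + t) ≤ K * (1 + w s + w t)

def wnorm (W : WeightFunction) (lam : ℝ) {E : Type*} [NormedAddCommGroup E]
    [MeasurableSpace E] (μ : Measure E) {F : Type*} [NormedAddCommGroup F]
    (f : E → F) (p : ℝ≥0∞) : ℝ≥0∞ :=
  eLpNorm (fun t => Real.exp (lam * W.w ‖t‖) * ‖f t‖) p μ

def SOmega {N : ℕ} (W : WeightFunction) (f : RN N → ℂ) : Prop :=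
  ∀ lam : ℝ, 0 < lam →
    (∃ C, ∀ x, Real.exp (lam * W.w ‖x‖) * ‖f x‖ ≤ C) ∧
    (∃ C, ∀ ξ, Real.exp (lam * W.w ‖ξ‖) * ‖ftr f ξ‖ ≤ C)

def elpN {α : Type*} [MeasurableSpace α] (μ : Measure α) (h : α → ℝ≥0∞) (p : ℝ≥0∞) : ℝ≥0∞ :=
  if p = ∞ then essSup h μ else (∫⁻ z, (h z) ^ p.toReal ∂μ) ^ (1 / p.toReal)

end


open scoped FourierTransform SchwartzMap

lemma measurePreserving_shear {N : ℕ} (τ : ℝ) :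
    MeasurePreserving (fun z : RN N × RN N => (z.1 + τ • z.2, z.1 - (1 - τ) • z.2)) := by
  have h₁ : MeasurePreserving (fun z : RN N × RN N => (z.1, z.2 + τ • z.1)) :=
    (MeasurePreserving.id volume).skew_product
      (g := fun t y : RN N => y + τ • t) (by fun_prop)
      (.of_forall fun t => map_add_right_eq_self volume (τ • t))
  have h₂ : MeasurePreserving (fun z : RN N × RN N => (z.1, z.1 - z.2)) :=
    (MeasurePreserving.id volume).skew_product
      (g := fun y t : RN N => y - t) (by fun_prop)
      (.of_forall fun y => (volume.measurePreserving_sub_left y).map_eq)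
  have h₃ : MeasurePreserving (Prod.swap : RN N × RN N → RN N × RN N) :=
    Measure.measurePreserving_swap
  convert h₂.comp (h₃.comp (h₁.comp h₃)) using 1
  ext z i
  · simp
  · simp
    ring

lemma normSq_integral_eq {N : ℕ} (τ : ℝ) {u : RN N → ℂ} (hu : Integrable u) :
    ((‖∫ y, u y‖ ^ 2 : ℝ) : ℂ) =
      ∫ x, ∫ t, u (x + τ • t) * (starRingEnd ℂ) (u (x - (1 - τ) • t)) := by
  have hconj : Integrable (fun y => (starRingEnd ℂ) (u y)) :=
    (LinearIsometryEquiv.integrable_comp_iff Complex.conjLIE).2 hu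
  have hprod : Integrable (fun z : RN N × RN N => u z.1 * (starRingEnd ℂ) (u z.2)) :=
    hu.mul_prod hconj
  have hmp := measurePreserving_shear (N := N) τ
  have hcomp := hmp.integrable_comp_of_integrable hprod
  have hmap : ∫ z : RN N × RN N, u z.1 * (starRingEnd ℂ) (u z.2) =
      ∫ z : RN N × RN N, u (z.1 + τ • z.2) * (starRingEnd ℂ) (u (z.1 - (1 - τ) • z.2)) := by
    conv_lhs => rw [← hmp.map_eq]
    rw [integral_map hmp.aemeasurable (hmp.map_eq.symm ▸ hprod.aestronglyMeasurable)]
  refine Eq.trans ?_ (integral_prod _ hcomp)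
  rw [← Measure.volume_eq_prod]
  refine Eq.trans ?_ hmap
  rw [Measure.volume_eq_prod, integral_prod_mul u (fun y => (starRingEnd ℂ) (u y)), integral_conj,
    Complex.mul_conj, Complex.normSq_eq_norm_sq]

lemma dotR_eq_inner {N : ℕ} (x ξ : RN N) :
    dotR x ξ = inner ℝ (WithLp.toLp 2 x : EuclideanSpace ℝ (Fin N)) (WithLp.toLp 2 ξ) := by
  simp [dotR, PiLp.inner_apply, mul_comm]

lemma continuous_dotR {N : ℕ} : Continuous fun z : RN N × RN N => dotR z.1 z.2 := by
  unfold dotR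
  fun_prop

lemma continuous_exp_neg_dotR {N : ℕ} (ξ : RN N) :
    Continuous fun t : RN N => Complex.exp (-(Complex.I * (dotR t ξ : ℂ))) := by
  have := (continuous_dotR (N := N)).comp (Continuous.prodMk_left ξ)
  simp only [Function.comp_def] at this
  fun_prop

/-- The transport of a Schwartz function on `Fin N → ℝ` to Euclidean space. -/
noncomputable def toEuclideanSchwartz {N : ℕ} (F : 𝓢(RN N, ℂ)) :
    𝓢(EuclideanSpace ℝ (Fin N), ℂ) :=
  SchwartzMap.compCLMOfContinuousLinearEquiv ℂ (EuclideanSpace.equiv (Fin N) ℝ) F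

lemma ftr_eq_fourier {N : ℕ} (F : 𝓢(RN N, ℂ)) (ξ : RN N) :
    ftr F ξ = 𝓕 (toEuclideanSchwartz F) (WithLp.toLp 2 ((2 * Real.pi)⁻¹ • ξ)) := by
  rw [SchwartzMap.fourier_coe, Real.fourier_eq',
    ← (PiLp.volume_preserving_toLp (Fin N)).integral_comp
      (MeasurableEquiv.toLp 2 (Fin N → ℝ)).measurableEmbedding]
  unfold ftr
  congr 1 with x
  have : inner ℝ (WithLp.toLp 2 x : EuclideanSpace ℝ (Fin N))
      (WithLp.toLp 2 ((2 * Real.pi)⁻¹ • ξ)) = (2 * Real.pi)⁻¹ * dotR x ξ := by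
    rw [WithLp.toLp_smul, inner_smul_right, dotR_eq_inner]
  rw [this]
  have hpi : (Real.pi : ℂ) ≠ 0 := by exact_mod_cast Real.pi_ne_zero
  change _ = _ * F x
  congr 2
  push_cast
  field_simp

lemma integrable_ftr {N : ℕ} (F : 𝓢(RN N, ℂ)) : Integrable (ftr F) := by
  have h := (PiLp.volume_preserving_toLp (Fin N)).integrable_comp_of_integrable
    (𝓕 (toEuclideanSchwartz F)).integrable
  have := h.comp_smul (R := (2 * Real.pi)⁻¹) (by positivity)
  exact this.congr (.of_forall fun ξ => (ftr_eq_fourier F ξ).symm)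

lemma integral_exp_mul_ftr {N : ℕ} (F : 𝓢(RN N, ℂ)) (t : RN N) :
    ∫ ξ, Complex.exp (Complex.I * (dotR t ξ : ℂ)) * ftr F ξ = (2 * Real.pi) ^ N * F t := by
  have hinv : 𝓕⁻ (𝓕 (toEuclideanSchwartz F)) (WithLp.toLp 2 t) = F t := by
    rw [FourierTransform.fourierInv_fourier_eq]
    rfl
  rw [SchwartzMap.fourierInv_coe, Real.fourierInv_eq',
    ← (PiLp.volume_preserving_toLp (Fin N)).integral_comp
      (MeasurableEquiv.toLp 2 (Fin N → ℝ)).measurableEmbedding] at hinv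
  rw [← hinv]
  have hpi : (Real.pi : ℂ) ≠ 0 := by exact_mod_cast Real.pi_ne_zero
  have := Measure.integral_comp_smul_of_nonneg (volume : Measure (RN N))
    (fun ξ => Complex.exp (((2 * Real.pi * inner ℝ (WithLp.toLp 2 ξ : EuclideanSpace ℝ (Fin N))
      (WithLp.toLp 2 t) : ℝ) : ℂ) * Complex.I) •
        𝓕 (toEuclideanSchwartz F) (WithLp.toLp 2 ξ)) (2 * Real.pi)⁻¹ (hR := by positivity)
  simp only [Module.finrank_fin_fun] at this
  have h2 : ((2 * Real.pi : ℂ)) ^ N = (((2 * Real.pi) ^ N : ℝ) : ℂ) := by push_cast; rfl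
  rw [inv_pow, inv_inv] at this
  rw [h2, ← Complex.real_smul]
  refine Eq.trans ?_ this
  congr 1 with ξ
  rw [ftr_eq_fourier, WithLp.toLp_smul, inner_smul_left, real_inner_comm, ← dotR_eq_inner,
    smul_eq_mul]
  congr 2
  simp only [conj_trivial]
  push_cast
  field_simp

lemma norm_exp_neg_I_mul_ofReal (r : ℝ) : ‖Complex.exp (-(Complex.I * (r : ℂ)))‖ = 1 := by
  rw [← mul_neg, ← Complex.ofReal_neg, Complex.norm_exp_I_mul_ofReal]

/-- Parseval's formula for the non-normalized Fourier transform. -/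
lemma integral_ftr_mul {N : ℕ} (F : 𝓢(RN N, ℂ)) {H : RN N → ℂ} (hH : Integrable H) :
    ∫ ξ, ftr F ξ * ∫ t, Complex.exp (Complex.I * (dotR t ξ : ℂ)) * H t =
      (2 * Real.pi) ^ N * ∫ t, F t * H t := by
  have hint : Integrable (Function.uncurry fun ξ t : RN N =>
      ftr F ξ * (Complex.exp (Complex.I * (dotR t ξ : ℂ)) * H t)) := by
    have h := (integrable_ftr F).mul_prod hH
    have hc : Continuous fun z : RN N × RN N =>
        Complex.exp (Complex.I * (dotR z.2 z.1 : ℂ)) := by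
      have := (continuous_dotR (N := N)).comp continuous_swap
      simp only [Function.comp_def, Prod.fst_swap, Prod.snd_swap] at this
      fun_prop
    refine (h.bdd_mul (c := 1) hc.aestronglyMeasurable
      (.of_forall fun z => (Complex.norm_exp_I_mul_ofReal _).le)).congr (.of_forall fun z => ?_)
    simp only [Function.uncurry]
    ring
  simp_rw [← integral_const_mul]
  rw [integral_integral_swap hint]
  congr 1 with t
  rw [← mul_assoc, ← integral_exp_mul_ftr, ← integral_mul_const]
  congr 1 with ξ
  ring

lemma dotR_sub_right {N : ℕ} (t ξ η : RN N) : dotR t (ξ - η) = dotR t ξ - dotR t η := by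
  simp [dotR, mul_sub]

lemma dotR_sub_left {N : ℕ} (t s ξ : RN N) : dotR (t - s) ξ = dotR t ξ - dotR s ξ := by
  simp [dotR, sub_mul]

/-- Complex conjugation of Schwartz functions. -/
noncomputable def conjSchwartz {N : ℕ} (f : 𝓢(RN N, ℂ)) : 𝓢(RN N, ℂ) :=
  SchwartzMap.postcompCLM (𝕜 := ℝ) (Complex.conjCLE : ℂ →L[ℝ] ℂ) f

lemma exists_schwartz_affine {N : ℕ} (f : 𝓢(RN N, ℂ)) (x : RN N) {r : ℝ} (hr : r ≠ 0) :
    ∃ F : 𝓢(RN N, ℂ), ∀ t, F t = f (x + r • t) := by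
  refine ⟨(SchwartzMap.compCLMOfContinuousLinearEquiv ℂ
    (ContinuousLinearEquiv.smulLeft (Units.mk0 r hr)))
    (SchwartzMap.compSubConstCLM ℂ (-x) f), fun t => ?_⟩
  change f (r • t - -x) = _
  rw [sub_neg_eq_add, add_comm]

lemma exists_schwartz_wig {N : ℕ} {τ : ℝ} (hτ : τ ∈ Set.Ioo (0 : ℝ) 1) (f : 𝓢(RN N, ℂ))
    (x : RN N) :
    ∃ F : 𝓢(RN N, ℂ), ∀ t,
      F t = f (x + τ • t) * (starRingEnd ℂ) (f (x - (1 - τ) • t)) := by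
  obtain ⟨F₁, h₁⟩ := exists_schwartz_affine f x hτ.1.ne'
  obtain ⟨F₂, h₂⟩ := exists_schwartz_affine (conjSchwartz f) x (r := -(1 - τ))
    (by linarith [hτ.2])
  refine ⟨SchwartzMap.pairing (.mul ℂ ℂ) F₁ F₂, fun t => ?_⟩
  rw [SchwartzMap.pairing_apply_apply, ContinuousLinearMap.mul_apply', h₁, h₂, neg_smul,
    ← sub_eq_add_neg]
  rfl

/-- The convolution in the frequency variable of two Wigner transforms. -/
lemma integral_wig_mul_wig {N : ℕ} {τ : ℝ} (hτ : τ ∈ Set.Ioo (0 : ℝ) 1) (f g : 𝓢(RN N, ℂ))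
    (x x' ξ : RN N) :
    ∫ ξ', wig τ f x' ξ' * wig (1 - τ) (fun t => g (-t)) (x - x') (ξ - ξ') =
      (2 * Real.pi) ^ N * ∫ t, (f (x' + τ • t) * (starRingEnd ℂ) (f (x' - (1 - τ) • t))) *
        (Complex.exp (-(Complex.I * (dotR t ξ : ℂ))) *
          (g (x' - (1 - τ) • t - x) * (starRingEnd ℂ) (g (x' + τ • t - x)))) := by
  obtain ⟨F, hF⟩ := exists_schwartz_wig hτ f x'
  obtain ⟨G, hG⟩ := exists_schwartz_wig hτ (conjSchwartz g) (x' - x)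
  have hG' : ∀ t, G t = g (x' - (1 - τ) • t - x) * (starRingEnd ℂ) (g (x' + τ • t - x)) := by
    intro t
    rw [hG, mul_comm]
    change (starRingEnd ℂ) ((starRingEnd ℂ) (g _)) * (starRingEnd ℂ) (g _) = _
    rw [Complex.conj_conj]
    rw [sub_right_comm, sub_add_eq_add_sub]
  simp_rw [← hF, ← hG']
  have hH : Integrable fun t => Complex.exp (-(Complex.I * (dotR t ξ : ℂ))) * G t :=
    G.integrable.bdd_mul (c := 1) (continuous_exp_neg_dotR ξ).aestronglyMeasurable
      (.of_forall fun t => (norm_exp_neg_I_mul_ofReal _).le)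
  rw [← integral_ftr_mul F hH]
  congr 1 with ξ'
  congr 1
  · unfold wig ftr
    congr 1 with t
    rw [hF, mul_assoc]
  · unfold wig
    congr 1 with t
    rw [hG', ← mul_assoc, ← Complex.exp_add, mul_assoc]
    have e : -(Complex.I * (dotR t (ξ - ξ') : ℂ)) =
        Complex.I * (dotR t ξ' : ℂ) + -(Complex.I * (dotR t ξ : ℂ)) := by
      rw [dotR_sub_right]
      push_cast
      ring
    have h₁ : -(x - x' + (1 - τ) • t) = x' - (1 - τ) • t - x := by module
    have h₂ : -(x - x' - (1 - (1 - τ)) • t) = x' + τ • t - x := by module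
    beta_reduce
    rw [e, h₁, h₂]

lemma spec_eq {N : ℕ} (τ : ℝ) (f g : 𝓢(RN N, ℂ)) (x ξ : RN N) :
    ((spec g f x ξ : ℝ) : ℂ) =
      ∫ x', ∫ t, (f (x' + τ • t) * (starRingEnd ℂ) (f (x' - (1 - τ) • t))) *
        (Complex.exp (-(Complex.I * (dotR t ξ : ℂ))) *
          (g (x' - (1 - τ) • t - x) * (starRingEnd ℂ) (g (x' + τ • t - x)))) := by
  have hu : Integrable fun y => f y * (starRingEnd ℂ) (g (y - x)) *
      Complex.exp (-(Complex.I * (dotR y ξ : ℂ))) := by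
    have h : Integrable (SchwartzMap.pairing (.mul ℂ ℂ) f
        (SchwartzMap.compSubConstCLM ℂ x (conjSchwartz g))) := SchwartzMap.integrable _
    refine (h.bdd_mul (c := 1) (continuous_exp_neg_dotR ξ).aestronglyMeasurable
      (.of_forall fun t => (norm_exp_neg_I_mul_ofReal _).le)).congr (.of_forall fun y => ?_)
    simp only [SchwartzMap.pairing_apply_apply, ContinuousLinearMap.mul_apply']
    rw [mul_comm]
    rfl
  unfold spec stft
  rw [normSq_integral_eq τ hu]
  congr 1 with x'
  congr 1 with t
  simp only [map_mul, Complex.conj_conj, ← Complex.exp_conj, map_neg, Complex.conj_I,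
    Complex.conj_ofReal]
  have e : Complex.exp (-(Complex.I * (dotR t ξ : ℂ))) =
      Complex.exp (-(Complex.I * (dotR (x' + τ • t) ξ : ℂ))) *
        Complex.exp (-(-Complex.I * (dotR (x' - (1 - τ) • t) ξ : ℂ))) := by
    have ht : t = (x' + τ • t) - (x' - (1 - τ) • t) := by module
    rw [← Complex.exp_add]
    conv_lhs => rw [ht, dotR_sub_left]
    congr 1
    push_cast
    ring
  rw [e]
  ring

lemma stronglyMeasurable_wig {N : ℕ} (τ : ℝ) {f : RN N → ℂ} (hf : Continuous f) :
    StronglyMeasurable fun z : RN N × RN N => wig τ f z.1 z.2 := by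
  unfold wig
  refine StronglyMeasurable.integral_prod_right
    (f := fun (z : RN N × RN N) (t : RN N) => Complex.exp (-(Complex.I * (dotR t z.2 : ℂ))) *
      f (z.1 + τ • t) * (starRingEnd ℂ) (f (z.1 - (1 - τ) • t))) ?_
  have h : Continuous fun p : (RN N × RN N) × RN N => dotR p.2 p.1.2 :=
    continuous_dotR.comp (continuous_snd.prodMk (continuous_snd.comp continuous_fst))
  exact Continuous.stronglyMeasurable (by simp only [Function.uncurry_def]; fun_prop)

/-- The spectrogram is dominated by the convolution of the two Wigner transforms. -/
lemma enorm_spec_le {N : ℕ} {τ : ℝ} (hτ : τ ∈ Set.Ioo (0 : ℝ) 1) (f g : 𝓢(RN N, ℂ))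
    (z : RN N × RN N) :
    ‖spec g f z.1 z.2‖ₑ ≤ ∫⁻ z' : RN N × RN N, ‖wig τ f z'.1 z'.2‖ₑ *
      ‖wig (1 - τ) (fun t => g (-t)) (z - z').1 (z - z').2‖ₑ := by
  have hm : Measurable fun z' : RN N × RN N => ‖wig τ f z'.1 z'.2‖ₑ *
      ‖wig (1 - τ) (fun t => g (-t)) (z - z').1 (z - z').2‖ₑ :=
    (stronglyMeasurable_wig τ f.continuous).enorm.mul
      ((stronglyMeasurable_wig (1 - τ) (f := fun t => g (-t))
        (g.continuous.comp continuous_neg)).enorm.comp (measurable_const.sub measurable_id))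
  have hE : ‖spec g f z.1 z.2‖ₑ = ‖((spec g f z.1 z.2 : ℝ) : ℂ)‖ₑ := by
    simp only [← ofReal_norm, Complex.norm_real]
  rw [hE, spec_eq τ, Measure.volume_eq_prod, lintegral_prod _ hm.aemeasurable]
  refine (enorm_integral_le_lintegral_enorm _).trans (lintegral_mono fun x' => ?_)
  have key := integral_wig_mul_wig hτ f g z.1 x' z.2
  refine le_trans ?_ ((enorm_integral_le_lintegral_enorm (fun ξ' => wig τ f x' ξ' *
    wig (1 - τ) (fun t => g (-t)) (z.1 - x') (z.2 - ξ'))).trans_eq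
      (lintegral_congr fun ξ' => enorm_mul _ _))
  rw [key, enorm_mul]
  refine le_mul_of_one_le_left' ?_
  rw [← ofReal_norm, ENNReal.one_le_ofReal, norm_pow]
  refine one_le_pow₀ ?_
  rw [norm_mul, Complex.norm_real, Real.norm_of_nonneg Real.pi_pos.le]
  norm_num
  linarith [Real.pi_gt_three]

lemma WeightFunction.exp_le {E : Type*} [NormedAddCommGroup E] (W : WeightFunction) {lam : ℝ}
    (hlam : 0 ≤ lam) (z z' : E) :
    Real.exp (lam * W.w ‖z‖) ≤ Real.exp (W.K * lam) *
      (Real.exp (W.K * lam * W.w ‖z - z'‖) * Real.exp (W.K * lam * W.w ‖z'‖)) := by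
  rw [← Real.exp_add, ← Real.exp_add, Real.exp_le_exp]
  have h₁ : W.w ‖z‖ ≤ W.w (‖z - z'‖ + ‖z'‖) :=
    W.mono (norm_nonneg z) (add_nonneg (norm_nonneg (z - z')) (norm_nonneg z'))
      (by simpa using norm_add_le (z - z') z')
  have h₂ := W.subadd ‖z - z'‖ ‖z'‖ (norm_nonneg _) (norm_nonneg _)
  have := mul_le_mul_of_nonneg_left (h₁.trans h₂) hlam
  linarith

theorem stmt11 {N : ℕ} (W : WeightFunction) (τ : ℝ) (hτ : τ ∈ Set.Ioo (0 : ℝ) 1)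
    (g : SchwartzMap (RN N) ℂ) (hg : SOmega W ⇑g) (hg0 : ⇑g ≠ 0)
    (p q : ℝ≥0∞) (hp : 1 ≤ p) (hpq : 1 / p + 1 / q = 1)
    (lam : ℝ) (hlam : 0 ≤ lam)
    (f : SchwartzMap (RN N) ℂ) (hf : SOmega W ⇑f) :
    wnorm W lam MeasureTheory.volume (fun z : RN N × RN N => spec ⇑g ⇑f z.1 z.2) ⊤ ≤
      ENNReal.ofReal (Real.exp (W.K * lam)) *
      wnorm W (W.K * lam) MeasureTheory.volume
        (fun z : RN N × RN N => wig (1 - τ) (fun t => g (-t)) z.1 z.2) q *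
      wnorm W (W.K * lam) MeasureTheory.volume
        (fun z : RN N × RN N => wig τ ⇑f z.1 z.2) p := by
  unfold wnorm
  have hw : Continuous fun z : RN N × RN N => Real.exp (W.K * lam * W.w ‖z‖) :=
    Real.continuous_exp.comp (continuous_const.mul (W.cont.comp continuous_norm))
  have hA := hw.stronglyMeasurable.mul (stronglyMeasurable_wig τ f.continuous).norm
  have hB := hw.stronglyMeasurable.mul (stronglyMeasurable_wig (1 - τ) (f := fun t => g (-t))
    (g.continuous.comp continuous_neg)).norm
  set A : RN N × RN N → ℝ := fun z => Real.exp (W.K * lam * W.w ‖z‖) * ‖wig τ f z.1 z.2‖ with hAdef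
  set B : RN N × RN N → ℝ := fun z => Real.exp (W.K * lam * W.w ‖z‖) *
    ‖wig (1 - τ) (fun t => g (-t)) z.1 z.2‖ with hBdef
  change StronglyMeasurable A at hA
  change StronglyMeasurable B at hB
  have : ENNReal.HolderTriple q p 1 := ⟨by
    rw [inv_one, ← hpq, one_div, one_div, add_comm]⟩
  rw [eLpNorm_exponent_top]
  refine eLpNormEssSup_le_of_ae_enorm_bound (.of_forall fun z => ?_)
  have hsub : MeasurePreserving (fun z' : RN N × RN N => z - z') :=
    (volume.measurePreserving_sub_left z.1).prod (volume.measurePreserving_sub_left z.2)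
  have holder : ∫⁻ z', ‖B (z - z')‖ₑ * ‖A z'‖ₑ ≤ eLpNorm B q volume * eLpNorm A p volume := by
    have h := eLpNorm_smul_le_mul_eLpNorm (p := q) (q := p) (r := 1) (μ := volume)
      hA.aestronglyMeasurable (hB.comp_measurable hsub.measurable).aestronglyMeasurable
    rw [eLpNorm_comp_measurePreserving hB.aestronglyMeasurable hsub,
      eLpNorm_one_eq_lintegral_enorm] at h
    simpa only [Pi.smul_apply', smul_eq_mul, enorm_mul, Function.comp_apply] using h
  rw [mul_assoc]
  refine le_trans ?_ (mul_le_mul_right holder _)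
  rw [enorm_mul, enorm_norm, ← lintegral_const_mul' _ _ ENNReal.ofReal_ne_top]
  refine (mul_le_mul_right (enorm_spec_le hτ f g z) _).trans ?_
  rw [← lintegral_const_mul' _ _ enorm_ne_top]
  refine lintegral_mono fun z' => ?_
  have hexp : ‖Real.exp (lam * W.w ‖z‖)‖ₑ ≤ ENNReal.ofReal (Real.exp (W.K * lam)) *
      (‖Real.exp (W.K * lam * W.w ‖z - z'‖)‖ₑ * ‖Real.exp (W.K * lam * W.w ‖z'‖)‖ₑ) := by
    simp only [Real.enorm_of_nonneg (Real.exp_nonneg _)]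
    rw [← ENNReal.ofReal_mul (Real.exp_nonneg _), ← ENNReal.ofReal_mul (Real.exp_nonneg _)]
    exact ENNReal.ofReal_le_ofReal (W.exp_le hlam z z')
  refine (mul_le_mul_left hexp _).trans_eq ?_
  simp only [hAdef, hBdef, enorm_mul, enorm_norm]
  ring
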